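/- arXiv:2510.24387 — 3 statements merged into one kernel-verified Lean document; each statement's English description precedes it below -/
import Mathlib

section
/- Let n, d be integers with 2 ≤ d ≤ n−1 and let D_{n,d} be the balanced double broom. Then J_min(D_{n,d}) equals: (d−2)n² − (d²−2d)n + (d³−3d²+2d)/3 if n is odd and d is odd; (d−2)n² − (d²−2d−1)n + (d³−3d²−d)/3 + 1 if n is odd and d is even; (d−2)n² − (d²−2d−2)n + (d³−3d²−d)/3 if n is even and d is odd; (d−2)n² − (d²−2d−1)n + (d³−3d²+2d)/3 − 1 if n is even and d is even. -/
open Finset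
open scoped Classical

/-- The degree of vertex `v` in `G`. -/
noncomputable def gdeg {V : Type*} [Fintype V] (G : SimpleGraph V) (v : V) : ℕ :=
  (Finset.univ.filter fun u => G.Adj v u).card

/-- `ℓ(u,v;w) = (d(u,w) + d(v,w) - d(u,v))/2`. -/
noncomputable def ell {V : Type*} (G : SimpleGraph V) (u v w : V) : ℚ :=
  ((G.dist u w : ℚ) + (G.dist v w : ℚ) - (G.dist u v : ℚ)) / 2

/-- The hitting time `H(u,w) = Σ_v ℓ(u,v;w)·deg(v)` (valid formula on trees). -/
noncomputable def hitTime {V : Type*} [Fintype V] (G : SimpleGraph V) (u w : V) : ℚ :=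
  ∑ v, ell G u v w * (gdeg G v : ℚ)

/-- The joining time to `w`: `J(w) = Σ_u deg(u)·H(u,w)`. -/
noncomputable def joinTime {V : Type*} [Fintype V] (G : SimpleGraph V) (w : V) : ℚ :=
  ∑ u, (gdeg G u : ℚ) * hitTime G u w

/-- `J_min(G) = min_{w} J(w)` (junk value 0 on the empty graph). -/
noncomputable def Jmin {V : Type*} [Fintype V] (G : SimpleGraph V) : ℚ :=
  if h : Nonempty V then
    haveI := h
    Finset.univ.inf' Finset.univ_nonempty (joinTime G)
  else 0

/-- The best meeting time `T_bestmeet(G) = J_min(G)/(2(n-1))`. -/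
noncomputable def bestMeet {V : Type*} [Fintype V] (G : SimpleGraph V) : ℚ :=
  Jmin G / (2 * ((Fintype.card V : ℚ) - 1))

/-- The diameter of `G` : the maximum of `d(u,v)` over pairs of vertices. -/
noncomputable def gdiam {V : Type*} [Fintype V] (G : SimpleGraph V) : ℕ :=
  Finset.univ.sup fun p : V × V => G.dist p.1 p.2

/-- The lever of order `n` and diameter `d` with fulcrum `v_k`: a path `v_0, …, v_d`
(on vertices `0, …, d`) together with `n - d - 1` pendant leaves (vertices `d+1, …, n-1`)
all adjacent to `v_k`. -/
def leverGraph (n d k : ℕ) : SimpleGraph (Fin n) :=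
  SimpleGraph.fromRel fun i j =>
    (i.val + 1 = j.val ∧ j.val ≤ d) ∨ (i.val = k ∧ d < j.val)

/-- The balanced lever `L_{n,d}`: the lever with fulcrum `v_{⌊d/2⌋}`. -/
def balancedLever (n d : ℕ) : SimpleGraph (Fin n) :=
  leverGraph n d (d / 2)

/-- The double broom of order `n`, diameter `d`, with `a` extra pendant leaves adjacent
to `v_1` and `n - d - 1 - a` extra pendant leaves adjacent to `v_{d-1}`.  The path
`v_0, …, v_d` sits on vertices `0, …, d`, the leaves at `v_1` are `d+1, …, d+a`, and the
leaves at `v_{d-1}` are `d+a+1, …, n-1`. -/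
def doubleBroom (n d a : ℕ) : SimpleGraph (Fin n) :=
  SimpleGraph.fromRel fun i j =>
    (i.val + 1 = j.val ∧ j.val ≤ d) ∨
    (i.val = 1 ∧ d < j.val ∧ j.val ≤ d + a) ∨
    (i.val = d - 1 ∧ d + a < j.val)

/-- The balanced double broom `D_{n,d}`, with `⌊(n-d-1)/2⌋` leaves at `v_1`
and `⌈(n-d-1)/2⌉` leaves at `v_{d-1}`. -/
def balancedDoubleBroom (n d : ℕ) : SimpleGraph (Fin n) :=
  doubleBroom n d ((n - d - 1) / 2)

/-- The broom `B_{n,d}`: a path `v_0, …, v_d` with `n - d - 1` pendant leaves adjacent to `v_1`. -/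
def broomGraph (n d : ℕ) : SimpleGraph (Fin n) :=
  doubleBroom n d (n - d - 1)

/-- The star `S_n = K_{1,n-1}` with center `0`. -/
def starGraph (n : ℕ) : SimpleGraph (Fin n) :=
  SimpleGraph.fromRel fun i _ => i.val = 0

/-- A function `f` on the vertices is the distance to `w` as soon as it vanishes only at `w`,
changes by at most one along edges, and can be decreased by one along an edge
wherever it is nonzero. -/
theorem dist_eq_of_descent {V : Type*} (G : SimpleGraph V) (w : V) (f : V → ℕ)
    (hw : f w = 0) (hzero : ∀ v, f v = 0 → v = w)
    (hlip : ∀ u v, G.Adj u v → f u ≤ f v + 1)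
    (hdesc : ∀ v, f v ≠ 0 → ∃ u, G.Adj v u ∧ f v = f u + 1) (v : V) :
    G.dist v w = f v := by
  have hle : ∀ (u v : V) (p : G.Walk u v), f u ≤ f v + p.length := by
    intro u v p
    induction p with
    | nil => simp
    | cons h p ih =>
      have := hlip _ _ h
      simp only [SimpleGraph.Walk.length_cons]
      omega
  have hwalk : ∀ (k : ℕ) (v : V), f v = k → ∃ p : G.Walk v w, p.length = k := by
    intro k
    induction k with
    | zero =>
      intro v hv
      obtain rfl := hzero v hv
      exact ⟨SimpleGraph.Walk.nil, rfl⟩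
    | succ k ih =>
      intro v hv
      obtain ⟨u, hadj, hu⟩ := hdesc v (by omega)
      obtain ⟨p, hp⟩ := ih u (by omega)
      exact ⟨SimpleGraph.Walk.cons hadj p, by simp [hp]⟩
  obtain ⟨p, hp⟩ := hwalk (f v) v rfl
  apply le_antisymm
  · exact hp ▸ SimpleGraph.dist_le p
  · obtain ⟨q, hq⟩ := p.reachable.exists_walk_length_eq_dist
    have := hle v w q
    omega

/-- The directed relation underlying the double broom: `i` is the parent of `j` in the tree
rooted at `v_0`. -/
def broomParent (d a i j : ℕ) : Prop :=
  (i + 1 = j ∧ j ≤ d) ∨ (i = 1 ∧ d < j ∧ j ≤ d + a) ∨ (i = d - 1 ∧ d + a < j)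

/-- The position of a vertex of the double broom along the path `v_0, …, v_d`, leaves at `v_1`
being placed at `v_0` and leaves at `v_{d-1}` at `v_d`. -/
def broomPos (d a i : ℕ) : ℕ :=
  if i ≤ d then i else if i ≤ d + a then 0 else d

/-- The distance between two vertices of the double broom. -/
def broomDist (d a i j : ℕ) : ℕ :=
  if i = j then 0
  else if broomPos d a i = broomPos d a j then 2
  else (broomPos d a i - broomPos d a j) + (broomPos d a j - broomPos d a i)

theorem broomDist_le_succ {d a i j : ℕ} (hd : 2 ≤ d) (h : broomParent d a i j) (k : ℕ) :
    broomDist d a i k ≤ broomDist d a j k + 1 ∧ broomDist d a j k ≤ broomDist d a i k + 1 := by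
  simp only [broomParent] at h
  simp only [broomDist, broomPos]
  constructor <;> split_ifs <;> omega

theorem exists_broomDist_eq_succ {n d a i j : ℕ} (hd : 2 ≤ d) (hn : d < n) (hjn : j < n)
    (hij : i ≠ j) :
    ∃ k < n, (broomParent d a i k ∨ broomParent d a k i) ∧
      broomDist d a i j = broomDist d a k j + 1 := by
  have hpos : ∀ k ≤ d, broomPos d a k = k := fun k hk => if_pos hk
  have hj : broomPos d a j = j ∧ j ≤ d ∨ broomPos d a j = 0 ∧ d < j ∧ j ≤ d + a ∨
      broomPos d a j = d ∧ d + a < j ∧ d < j := by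
    unfold broomPos
    split_ifs <;> omega
  obtain hi | hi | hi : (i = 0 ∨ d < i ∧ i ≤ d + a) ∨ (i = d ∨ d + a < i) ∨ (0 < i ∧ i < d) := by
    omega
  · refine ⟨1, by omega, by unfold broomParent; omega, ?_⟩
    have hp : broomPos d a i = 0 := by
      unfold broomPos
      split_ifs <;> omega
    rw [broomDist, broomDist, hp, hpos 1 (by omega)]
    split_ifs <;> omega
  · refine ⟨d - 1, by omega, by unfold broomParent; omega, ?_⟩
    have hp : broomPos d a i = d := by
      unfold broomPos
      split_ifs <;> omega
    rw [broomDist, broomDist, hp, hpos (d - 1) (by omega)]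
    split_ifs <;> omega
  · by_cases hadj : broomParent d a i j ∧ d < j
    · refine ⟨j, hjn, Or.inl hadj.1, ?_⟩
      unfold broomParent at hadj
      unfold broomDist broomPos
      split_ifs <;> omega
    unfold broomParent at hadj
    by_cases hlt : i < broomPos d a j
    · refine ⟨i + 1, by omega, by unfold broomParent; omega, ?_⟩
      rw [broomDist, broomDist, hpos i (by omega), hpos (i + 1) (by omega)]
      split_ifs <;> omega
    · refine ⟨i - 1, by omega, by unfold broomParent; omega, ?_⟩
      rw [broomDist, broomDist, hpos i (by omega), hpos (i - 1) (by omega)]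
      split_ifs <;> omega

theorem doubleBroom_adj {n d a : ℕ} (hd : 2 ≤ d) (u v : Fin n) :
    (doubleBroom n d a).Adj u v ↔ broomParent d a u v ∨ broomParent d a v u := by
  simp only [doubleBroom, SimpleGraph.fromRel_adj, broomParent, ne_eq, Fin.ext_iff]
  omega

theorem dist_doubleBroom {n d a : ℕ} (hd : 2 ≤ d) (hn : d < n) (u w : Fin n) :
    (doubleBroom n d a).dist u w = broomDist d a u w := by
  refine dist_eq_of_descent _ w (fun v => broomDist d a v w) (by simp [broomDist]) ?_ ?_ ?_ u
  · intro v hv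
    rw [Fin.ext_iff]
    simp only [broomDist] at hv
    split_ifs at hv <;> omega
  · intro u v h
    rw [doubleBroom_adj hd] at h
    rcases h with h | h
    · exact (broomDist_le_succ hd h w).1
    · exact (broomDist_le_succ hd h w).2
  · intro v hv
    have hvw : (v : ℕ) ≠ w := fun h => hv (by simp [broomDist, h])
    obtain ⟨k, hk, hadj, hdist⟩ := exists_broomDist_eq_succ (a := a) hd hn w.isLt hvw
    exact ⟨⟨k, hk⟩, (doubleBroom_adj hd _ _).2 hadj, hdist⟩

/-- The sum of `deg(v) f(v)` over the vertices of the double broom with `a` and `b` extra leaves,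
written as a sum over the edges. -/
def broomSum (d a b : ℕ) (f : ℕ → ℚ) : ℚ :=
  ∑ i ∈ range d, (f i + f (i + 1)) + ∑ x ∈ range a, (f 1 + f (d + 1 + x))
    + ∑ y ∈ range b, (f (d - 1) + f (d + 1 + a + y))

theorem sum_gdeg_mul_doubleBroom {d : ℕ} (a b : ℕ) (hd : 2 ≤ d) (f : ℕ → ℚ) :
    ∑ u : Fin (d + 1 + a + b), (gdeg (doubleBroom (d + 1 + a + b) d a) u : ℚ) * f u
      = broomSum d a b f := by
  have hexp : ∀ u : Fin (d + 1 + a + b),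
      (gdeg (doubleBroom (d + 1 + a + b) d a) u : ℚ) * f u
        = ∑ v : Fin (d + 1 + a + b), ((if broomParent d a u v then f u else 0)
            + (if broomParent d a v u then f u else 0)) := by
    intro u
    rw [gdeg, Finset.card_filter, Nat.cast_sum, Finset.sum_mul]
    refine Finset.sum_congr rfl fun v _ => ?_
    rw [doubleBroom_adj hd]
    have hasymm : ¬ (broomParent d a u v ∧ broomParent d a v u) := by
      simp only [broomParent]
      omega
    by_cases h1 : broomParent d a u v <;> by_cases h2 : broomParent d a v u <;> simp_all
  simp only [hexp, Finset.sum_add_distrib]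
  rw [Finset.sum_comm (f := fun u v : Fin (d + 1 + a + b) =>
    if broomParent d a u v then f u else 0), ← Finset.sum_add_distrib]
  simp only [← Finset.sum_add_distrib]
  have hval : ∀ v : ℕ, ∑ u : Fin (d + 1 + a + b),
      ((if broomParent d a u v then f u else 0) + (if broomParent d a u v then f v else 0))
        = ∑ u ∈ range (d + 1 + a + b), if broomParent d a u v then f u + f v else 0 := by
    intro v
    rw [← Fin.sum_univ_eq_sum_range (fun u => if broomParent d a u v then f u + f v else 0)]
    refine Finset.sum_congr rfl fun u _ => ?_
    split_ifs <;> simp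
  have hparent : ∀ v p : ℕ, p < d + 1 + a + b → (∀ u, broomParent d a u v ↔ u = p) →
      ∑ u ∈ range (d + 1 + a + b), (if broomParent d a u v then f u + f v else 0)
        = f p + f v := by
    intro v p hp h
    simp [h, hp]
  simp only [hval]
  rw [Fin.sum_univ_eq_sum_range (fun v => ∑ u ∈ range (d + 1 + a + b),
      if broomParent d a u v then f u + f v else 0), Finset.sum_range_add,
    Finset.sum_range_add, Finset.sum_range_succ', broomSum]
  have hroot : ∀ u, ¬ broomParent d a u 0 := by
    intro u
    simp only [broomParent]
    omega
  simp only [hroot, if_false, Finset.sum_const_zero, add_zero]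
  congr 1
  · congr 1
    · refine Finset.sum_congr rfl fun i hi => hparent _ _ ?_ fun u => ?_
      all_goals have := Finset.mem_range.1 hi
      · omega
      · simp only [broomParent]
        omega
    · refine Finset.sum_congr rfl fun i hi => hparent _ _ ?_ fun u => ?_
      all_goals have := Finset.mem_range.1 hi
      · omega
      · simp only [broomParent]
        omega
  · refine Finset.sum_congr rfl fun i hi => hparent _ _ ?_ fun u => ?_
    all_goals have := Finset.mem_range.1 hi
    · omega
    · simp only [broomParent]
      omega

theorem sum_range_abs_sub {d k : ℕ} (hk : k ≤ d) :
    ∑ i ∈ range d, (|(i : ℚ) - k| + |((i + 1 : ℕ) : ℚ) - k|) = (k : ℚ) ^ 2 + ((d : ℚ) - k) ^ 2 := by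
  obtain ⟨m, rfl⟩ := Nat.exists_eq_add_of_le hk
  have hleft : ∀ j ≤ k, ∑ i ∈ range j, (|(i : ℚ) - k| + |((i + 1 : ℕ) : ℚ) - k|)
      = (k : ℚ) ^ 2 - ((k : ℚ) - j) ^ 2 := by
    intro j
    induction j with
    | zero => simp
    | succ j ih =>
      intro hj
      have hjk : (j : ℚ) + 1 ≤ k := by exact_mod_cast hj
      rw [Finset.sum_range_succ, ih (by omega)]
      push_cast
      rw [abs_of_nonpos (by linarith), abs_of_nonpos (by linarith)]
      ring
  rw [Finset.sum_range_add, hleft k le_rfl]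
  have hright : ∑ i ∈ range m, (|((k + i : ℕ) : ℚ) - k| + |((k + i + 1 : ℕ) : ℚ) - k|)
      = (m : ℚ) ^ 2 := by
    induction m with
    | zero => simp
    | succ m ih =>
      rw [Finset.sum_range_succ, ih (by omega)]
      push_cast
      rw [abs_of_nonneg (by linarith [(m.cast_nonneg : (0 : ℚ) ≤ m)]),
        abs_of_nonneg (by linarith [(m.cast_nonneg : (0 : ℚ) ≤ m)])]
      ring
  rw [hright]
  push_cast
  ring

theorem broomDist_cast (d a i j : ℕ) : (broomDist d a i j : ℚ)
    = |(broomPos d a i : ℚ) - broomPos d a j|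
      + if i ≠ j ∧ broomPos d a i = broomPos d a j then 2 else 0 := by
  unfold broomDist
  by_cases hij : i = j
  · simp [hij]
  generalize broomPos d a i = p
  generalize broomPos d a j = q
  by_cases hpq : p = q
  · simp [hij, hpq]
  rcases le_total p q with h | h
  · have : (p : ℚ) ≤ q := by exact_mod_cast h
    rw [abs_of_nonpos (by linarith)]
    simp [hij, hpq, Nat.sub_eq_zero_of_le h, Nat.cast_sub h]
  · have : (q : ℚ) ≤ p := by exact_mod_cast h
    rw [abs_of_nonneg (by linarith)]
    simp [hij, hpq, Nat.sub_eq_zero_of_le h, Nat.cast_sub h]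

/-- The sum of `deg(u) d(u,w)` over the vertices `u` of the double broom, as a function of the
position `k` of `w`, when `w` lies strictly inside the path. -/
def broomQuad (d a b : ℕ) (k : ℚ) : ℚ :=
  2 * a * k - a + 2 * b * (d - k) - b + k ^ 2 + (d - k) ^ 2

theorem broomSum_add (d a b : ℕ) (f g : ℕ → ℚ) :
    broomSum d a b (fun u => f u + g u) = broomSum d a b f + broomSum d a b g := by
  simp only [broomSum, Finset.sum_add_distrib]
  ring

theorem broomPos_of_le {d a i : ℕ} (h : i ≤ d) : broomPos d a i = i :=
  if_pos h

theorem broomPos_left {d a x : ℕ} (h : x < a) : broomPos d a (d + 1 + x) = 0 := by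
  unfold broomPos
  split_ifs <;> omega

theorem broomPos_right (d a y : ℕ) : broomPos d a (d + 1 + a + y) = d := by
  unfold broomPos
  split_ifs <;> omega

theorem broomPos_le (d a i : ℕ) : broomPos d a i ≤ d := by
  unfold broomPos
  split_ifs <;> omega

theorem broomSum_comp_broomPos {d : ℕ} (a b : ℕ) (hd : 2 ≤ d) (f : ℕ → ℚ) :
    broomSum d a b (fun u => f (broomPos d a u))
      = ∑ i ∈ range d, (f i + f (i + 1)) + a * (f 1 + f 0) + b * (f (d - 1) + f d) := by
  unfold broomSum
  congr 1
  · congr 1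
    · refine Finset.sum_congr rfl fun i hi => ?_
      have := Finset.mem_range.1 hi
      dsimp only
      rw [broomPos_of_le (by omega), broomPos_of_le (by omega)]
    · rw [Finset.sum_congr rfl (g := fun _ => f 1 + f 0)]
      · rw [Finset.sum_const, Finset.card_range, nsmul_eq_mul]
      · intro x hx
        dsimp only
        rw [broomPos_left (Finset.mem_range.1 hx), broomPos_of_le (by omega)]
  · rw [Finset.sum_congr rfl (g := fun _ => f (d - 1) + f d)]
    · rw [Finset.sum_const, Finset.card_range, nsmul_eq_mul]
    · intro x hx
      dsimp only
      rw [broomPos_right, broomPos_of_le (by omega)]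

theorem sum_range_ite_ne (m c w : ℕ) :
    ∑ x ∈ range m, (if c + x ≠ w then (2 : ℚ) else 0)
      = 2 * m - if c ≤ w ∧ w < c + m then 2 else 0 := by
  have hterm : ∀ x, (if c + x ≠ w then (2 : ℚ) else 0) = 2 - if c + x = w then 2 else 0 := by
    intro x
    split_ifs <;> simp_all
  simp only [hterm, Finset.sum_sub_distrib, Finset.sum_const, Finset.card_range, nsmul_eq_mul]
  rw [mul_comm]
  congr 1
  by_cases hc : c ≤ w
  · obtain ⟨k, rfl⟩ := Nat.exists_eq_add_of_le hc
    simp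
  · rw [if_neg (by omega)]
    exact Finset.sum_eq_zero fun x _ => if_neg (by omega)

theorem broomSum_same_pos {d a b w : ℕ} (hd : 2 ≤ d) (hw : w < d + 1 + a + b) :
    broomSum d a b (fun u => if u ≠ w ∧ broomPos d a u = broomPos d a w then 2 else 0)
      = (if broomPos d a w = 0 then 2 * (a : ℚ) else 0)
        + (if broomPos d a w = d then 2 * (b : ℚ) else 0) := by
  set e : ℕ → ℚ := fun u => if u ≠ w ∧ broomPos d a u = broomPos d a w then 2 else 0 with he
  have hq : broomPos d a w = w ∧ w ≤ d ∨ broomPos d a w = 0 ∧ d < w ∧ w ≤ d + a ∨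
      broomPos d a w = d ∧ d + a < w ∧ d < w := by
    unfold broomPos
    split_ifs <;> omega
  have hint : ∀ i, 0 < i → i < d → e i = 0 := by
    intro i h0 h1
    simp only [he]
    rw [broomPos_of_le h1.le, if_neg (by omega)]
  have hpath : ∑ i ∈ range d, (e i + e (i + 1)) = e 0 + e d := by
    rw [Finset.sum_add_distrib]
    congr 1
    · refine Finset.sum_eq_single_of_mem 0 (by simp; omega) fun i hi h0 => ?_
      exact hint i (by omega) (Finset.mem_range.1 hi)
    · rw [Finset.sum_eq_single_of_mem (d - 1) (by simp; omega), Nat.sub_add_cancel (by omega)]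
      intro i hi h0
      have := Finset.mem_range.1 hi
      exact hint (i + 1) (by omega) (by omega)
  have hleft : ∑ x ∈ range a, (e 1 + e (d + 1 + x)) = if broomPos d a w = 0
      then 2 * (a : ℚ) - (if d + 1 ≤ w ∧ w < d + 1 + a then 2 else 0) else 0 := by
    rw [hint 1 (by omega) (by omega), ← sum_range_ite_ne]
    rw [Finset.sum_congr rfl (g := fun x => if broomPos d a w = 0 then
      (if d + 1 + x ≠ w then (2 : ℚ) else 0) else 0)]
    · split_ifs <;> simp
    · intro x hx
      simp only [he, broomPos_left (Finset.mem_range.1 hx), zero_add, eq_comm (a := 0)]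
      rw [← ite_and]
      simp only [and_comm]
  have hright : ∑ y ∈ range b, (e (d - 1) + e (d + 1 + a + y)) = if broomPos d a w = d
      then 2 * (b : ℚ) - (if d + 1 + a ≤ w ∧ w < d + 1 + a + b then 2 else 0) else 0 := by
    rw [hint (d - 1) (by omega) (by omega), ← sum_range_ite_ne]
    rw [Finset.sum_congr rfl (g := fun x => if broomPos d a w = d then
      (if d + 1 + a + x ≠ w then (2 : ℚ) else 0) else 0)]
    · split_ifs <;> simp
    · intro x hx
      simp only [he, broomPos_right, zero_add, eq_comm (a := d)]
      rw [← ite_and]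
      simp only [and_comm]
  rw [broomSum, hpath, hleft, hright]
  simp only [he, broomPos_of_le (Nat.zero_le d), broomPos_of_le le_rfl]
  split_ifs <;> first | omega | ring

theorem broomSum_broomDist {d a b w : ℕ} (hd : 2 ≤ d) (hw : w < d + 1 + a + b) :
    broomSum d a b (fun u => broomDist d a u w) = broomQuad d a b (broomPos d a w)
      + (if broomPos d a w = 0 then 4 * (a : ℚ) else 0)
      + (if broomPos d a w = d then 4 * (b : ℚ) else 0) := by
  simp only [broomDist_cast]
  rw [broomSum_add, broomSum_same_pos hd hw,
    broomSum_comp_broomPos a b hd (fun i => |(i : ℚ) - broomPos d a w|),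
    sum_range_abs_sub (broomPos_le d a w), Nat.cast_sub (by omega : 1 ≤ d)]
  have hqd := broomPos_le d a w
  generalize broomPos d a w = q at *
  have hqd' : (q : ℚ) ≤ d := by exact_mod_cast hqd
  have hd' : (2 : ℚ) ≤ d := by exact_mod_cast hd
  have hq0 : (0 : ℚ) ≤ q := q.cast_nonneg
  push_cast
  rw [abs_of_nonpos (by linarith : (0 : ℚ) - q ≤ 0), abs_of_nonneg (by linarith : (0 : ℚ) ≤ d - q)]
  unfold broomQuad
  rcases Nat.eq_zero_or_pos q with rfl | hpos
  · rw [if_pos rfl, if_pos rfl, if_neg (by omega), if_neg (by omega), Nat.cast_zero,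
      abs_of_nonneg (by norm_num), abs_of_nonneg (by linarith)]
    ring
  have hq1 : (1 : ℚ) ≤ q := by exact_mod_cast hpos
  rcases hqd.eq_or_lt with rfl | hlt
  · rw [if_neg (by omega), if_pos rfl, if_neg (by omega), if_pos rfl,
      abs_of_nonpos (by linarith), abs_of_nonpos (by linarith)]
    ring
  · have hlt' : (q : ℚ) + 1 ≤ d := by exact_mod_cast hlt
    rw [if_neg (by omega), if_neg (by omega), if_neg (by omega), if_neg (by omega),
      abs_of_nonpos (by linarith), abs_of_nonneg (by linarith)]
    ring

theorem joinTime_eq {V : Type*} [Fintype V] (G : SimpleGraph V) (w : V) :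
    joinTime G w = (∑ u, (gdeg G u : ℚ)) * (∑ u, (gdeg G u : ℚ) * G.dist u w)
      - (∑ u, (gdeg G u : ℚ) * ∑ v, (gdeg G v : ℚ) * G.dist v u) / 2 := by
  have hhit : ∀ u, hitTime G u w = ((∑ v, (gdeg G v : ℚ)) * G.dist u w
      + (∑ v, (gdeg G v : ℚ) * G.dist v w) - ∑ v, (gdeg G v : ℚ) * G.dist v u) / 2 := by
    intro u
    rw [hitTime, Finset.sum_mul, ← Finset.sum_add_distrib, ← Finset.sum_sub_distrib,
      Finset.sum_div]
    refine Finset.sum_congr rfl fun v _ => ?_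
    rw [ell, G.dist_comm (u := u) (v := v)]
    ring
  simp only [joinTime, hhit]
  generalize hS : ∑ v, (gdeg G v : ℚ) * G.dist v w = S
  generalize hM : ∑ v, (gdeg G v : ℚ) = M
  have hterm : ∀ u, (gdeg G u : ℚ) * ((M * G.dist u w + S
      - ∑ v, (gdeg G v : ℚ) * G.dist v u) / 2)
      = M / 2 * ((gdeg G u : ℚ) * G.dist u w) + (gdeg G u : ℚ) * (S / 2)
        - (gdeg G u : ℚ) * (∑ v, (gdeg G v : ℚ) * G.dist v u) / 2 := by
    intro u
    ring
  simp only [hterm]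
  rw [Finset.sum_sub_distrib, Finset.sum_add_distrib, ← Finset.mul_sum, ← Finset.sum_mul,
    ← Finset.sum_div, hS, hM]
  ring

theorem sum_broomQuad (d a b : ℕ) :
    ∑ i ∈ range d, (broomQuad d a b i + broomQuad d a b ((i + 1 : ℕ) : ℚ))
      = 2 * a * d ^ 2 - 2 * (a + b) * d + 2 * b * d ^ 2 + 2 * (2 * (d : ℚ) ^ 3 + d) / 3 := by
  have hpartial : ∀ m : ℕ, ∑ i ∈ range m, (broomQuad d a b i + broomQuad d a b ((i + 1 : ℕ) : ℚ))
      = 2 * (a - b) * (m : ℚ) ^ 2 + 2 * m * (2 * b * d - a - b)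
        + (2 * (m : ℚ) ^ 3 + m) / 3 + 2 * d ^ 2 * m - 2 * d * (m : ℚ) ^ 2
        + (2 * (m : ℚ) ^ 3 + m) / 3 := by
    intro m
    induction m with
    | zero => simp
    | succ m ih =>
      rw [Finset.sum_range_succ, ih]
      unfold broomQuad
      push_cast
      ring
  rw [hpartial]
  ring

/-- The joining time of the double broom with `a` and `b` extra leaves to a vertex, as a function of
the position of that vertex. -/
theorem joinTime_doubleBroom {d : ℕ} (a b : ℕ) (hd : 2 ≤ d) (w : Fin (d + 1 + a + b)) :
    joinTime (doubleBroom (d + 1 + a + b) d a) w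
      = 2 * (d + a + b) * (broomQuad d a b (broomPos d a w)
          + (if broomPos d a w = 0 then 4 * (a : ℚ) else 0)
          + (if broomPos d a w = d then 4 * (b : ℚ) else 0))
        - (2 * a * d ^ 2 - 2 * (a + b) * d + 2 * b * d ^ 2 + 2 * (2 * (d : ℚ) ^ 3 + d) / 3
          + 4 * a + 4 * b + a * (broomQuad d a b 1 + broomQuad d a b 0 + 4 * a)
          + b * (broomQuad d a b (d - 1) + broomQuad d a b d + 4 * b)) / 2 := by
  have hS : ∀ w : Fin (d + 1 + a + b), ∑ u, (gdeg (doubleBroom (d + 1 + a + b) d a) u : ℚ)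
      * (doubleBroom (d + 1 + a + b) d a).dist u w = broomQuad d a b (broomPos d a w)
        + (if broomPos d a w = 0 then 4 * (a : ℚ) else 0)
        + (if broomPos d a w = d then 4 * (b : ℚ) else 0) := by
    intro w
    simp only [dist_doubleBroom hd (by omega : d < d + 1 + a + b)]
    rw [sum_gdeg_mul_doubleBroom a b hd (fun u => broomDist d a u w), broomSum_broomDist hd w.isLt]
  have hM : ∑ u, (gdeg (doubleBroom (d + 1 + a + b) d a) u : ℚ) = 2 * (d + a + b) := by
    have h := sum_gdeg_mul_doubleBroom a b hd (fun _ => 1)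
    simp only [mul_one] at h
    rw [h]
    simp [broomSum]
    ring
  rw [joinTime_eq, hM]
  simp only [hS]
  congr 2
  rw [sum_gdeg_mul_doubleBroom a b hd (fun u => broomQuad d a b (broomPos d a u)
        + (if broomPos d a u = 0 then 4 * (a : ℚ) else 0)
        + (if broomPos d a u = d then 4 * (b : ℚ) else 0)),
    broomSum_comp_broomPos a b hd (fun q => broomQuad d a b q
        + (if q = 0 then 4 * (a : ℚ) else 0) + (if q = d then 4 * (b : ℚ) else 0))]
  have hpath : ∑ i ∈ range d, ((broomQuad d a b i + (if i = 0 then 4 * (a : ℚ) else 0)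
      + (if i = d then 4 * (b : ℚ) else 0)) + (broomQuad d a b ((i + 1 : ℕ) : ℚ)
      + (if i + 1 = 0 then 4 * (a : ℚ) else 0) + (if i + 1 = d then 4 * (b : ℚ) else 0)))
      = ∑ i ∈ range d, (broomQuad d a b i + broomQuad d a b ((i + 1 : ℕ) : ℚ))
        + 4 * a + 4 * b := by
    have h0 : ∑ i ∈ range d, (if i = 0 then 4 * (a : ℚ) else 0) = 4 * a := by
      simp
      omega
    have h1 : ∑ i ∈ range d, (if i + 1 = d then 4 * (b : ℚ) else 0) = 4 * b := by
      rw [Finset.sum_eq_single_of_mem (d - 1) (by simp; omega)]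
      · exact if_pos (by omega)
      · intro i _ hi
        exact if_neg (by omega)
    refine Eq.trans ?_ (congrArg₂ (· + ·) (congrArg₂ (· + ·) rfl h0) h1)
    rw [← Finset.sum_add_distrib, ← Finset.sum_add_distrib]
    refine Finset.sum_congr rfl fun i hi => ?_
    rw [if_neg (by have := Finset.mem_range.1 hi; omega : ¬ i = d),
      if_neg (by omega : ¬ i + 1 = 0)]
    ring
  rw [hpath, sum_broomQuad, if_neg (by omega), if_neg (by omega), if_pos rfl,
    if_neg (by omega), if_neg (by omega), if_neg (by omega), if_neg (by omega), if_pos rfl,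
    Nat.cast_sub (by omega : 1 ≤ d)]
  push_cast
  ring

theorem Jmin_eq_of_forall_le {V : Type*} [Fintype V] (G : SimpleGraph V) (w : V)
    (h : ∀ v, joinTime G w ≤ joinTime G v) : Jmin G = joinTime G w := by
  rw [Jmin, dif_pos ⟨w⟩]
  exact le_antisymm (Finset.inf'_le _ (Finset.mem_univ w)) (Finset.le_inf' _ _ fun v _ => h v)

theorem Jmin_doubleBroom {d a b : ℕ} (hd : 2 ≤ d) (hab : b = a ∨ b = a + 1) :
    Jmin (doubleBroom (d + 1 + a + b) d a)
      = 2 * (d + a + b) * broomQuad d a b ((d + 1) / 2 : ℕ)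
        - (2 * a * d ^ 2 - 2 * (a + b) * d + 2 * b * d ^ 2 + 2 * (2 * (d : ℚ) ^ 3 + d) / 3
          + 4 * a + 4 * b + a * (broomQuad d a b 1 + broomQuad d a b 0 + 4 * a)
          + b * (broomQuad d a b (d - 1) + broomQuad d a b d + 4 * b)) / 2 := by
  set k := (d + 1) / 2 with hk
  have hquad : ∀ q : ℕ, broomQuad d a b k ≤ broomQuad d a b q := by
    intro q
    have hfactor : broomQuad d a b q - broomQuad d a b k
        = 2 * (((q : ℤ) - k) * (q + k - d - (b - a)) : ℤ) := by
      unfold broomQuad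
      push_cast
      ring
    have hnonneg : (0 : ℤ) ≤ ((q : ℤ) - k) * (q + k - d - (b - a)) := by
      rcases Nat.lt_or_ge q k with h | h
      · exact mul_nonneg_of_nonpos_of_nonpos (by omega) (by omega)
      · rcases h.eq_or_lt with h | h
        · simp [h]
        · exact mul_nonneg (by omega) (by omega)
    have : (0 : ℚ) ≤ (((q : ℤ) - k) * (q + k - d - (b - a)) : ℤ) := by exact_mod_cast hnonneg
    linarith
  have hpos : broomPos d a k = k := broomPos_of_le (by omega)
  have hJ := joinTime_doubleBroom a b hd ⟨k, by omega⟩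
  simp only [hpos] at hJ
  rw [if_neg (by omega), if_neg (by omega), add_zero, add_zero] at hJ
  rw [← hJ]
  refine Jmin_eq_of_forall_le _ _ fun v => ?_
  rw [hJ, joinTime_doubleBroom a b hd v]
  refine sub_le_sub_right (mul_le_mul_of_nonneg_left ?_ (by positivity)) _
  have hv := hquad (broomPos d a v)
  have h0 : (0 : ℚ) ≤ if broomPos d a v = 0 then 4 * (a : ℚ) else 0 := by
    split_ifs <;> positivity
  have h1 : (0 : ℚ) ≤ if broomPos d a v = d then 4 * (b : ℚ) else 0 := by
    split_ifs <;> positivity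
  linarith

/-- the minimum joining time of the balanced double broom `D_{n,d}`. -/
theorem Jmin_balancedDoubleBroom (n d : ℕ) (hd2 : 2 ≤ d) (hdn : d ≤ n - 1) :
    (Odd n → Odd d → Jmin (balancedDoubleBroom n d) =
      ((d : ℚ) - 2)*(n : ℚ)^2 - ((d : ℚ)^2 - 2*(d : ℚ))*(n : ℚ)
        + ((d : ℚ)^3 - 3*(d : ℚ)^2 + 2*(d : ℚ))/3) ∧
    (Odd n → Even d → Jmin (balancedDoubleBroom n d) =
      ((d : ℚ) - 2)*(n : ℚ)^2 - ((d : ℚ)^2 - 2*(d : ℚ) - 1)*(n : ℚ)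
        + ((d : ℚ)^3 - 3*(d : ℚ)^2 - (d : ℚ))/3 + 1) ∧
    (Even n → Odd d → Jmin (balancedDoubleBroom n d) =
      ((d : ℚ) - 2)*(n : ℚ)^2 - ((d : ℚ)^2 - 2*(d : ℚ) - 2)*(n : ℚ)
        + ((d : ℚ)^3 - 3*(d : ℚ)^2 - (d : ℚ))/3) ∧
    (Even n → Even d → Jmin (balancedDoubleBroom n d) =
      ((d : ℚ) - 2)*(n : ℚ)^2 - ((d : ℚ)^2 - 2*(d : ℚ) - 1)*(n : ℚ)
        + ((d : ℚ)^3 - 3*(d : ℚ)^2 + 2*(d : ℚ))/3 - 1) := by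
  obtain ⟨a, b, hab, rfl, ha⟩ : ∃ a b, (b = a ∨ b = a + 1) ∧ n = d + 1 + a + b ∧
      (n - d - 1) / 2 = a :=
    ⟨(n - d - 1) / 2, n - d - 1 - (n - d - 1) / 2, by omega, by omega, rfl⟩
  rw [balancedDoubleBroom, ha, Jmin_doubleBroom hd2 hab]
  obtain ⟨m, hm⟩ := Nat.even_or_odd' d
  refine ⟨fun hn hd => ?_, fun hn hd => ?_, fun hn hd => ?_, fun hn hd => ?_⟩ <;>
    simp only [Nat.odd_iff, Nat.even_iff] at hn hd
  · obtain rfl : d = 2 * m + 1 := by omega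
    obtain rfl : b = a + 1 := by omega
    rw [show (2 * m + 1 + 1) / 2 = m + 1 by omega]
    unfold broomQuad
    push_cast
    ring
  · obtain rfl : d = 2 * m := by omega
    obtain rfl : b = a := by omega
    rw [show (2 * m + 1) / 2 = m by omega]
    unfold broomQuad
    push_cast
    ring
  · obtain rfl : d = 2 * m + 1 := by omega
    obtain rfl : b = a := by omega
    rw [show (2 * m + 1 + 1) / 2 = m + 1 by omega]
    unfold broomQuad
    push_cast
    ring
  · obtain rfl : d = 2 * m := by omega
    obtain rfl : b = a + 1 := by omega
    rw [show (2 * m + 1) / 2 = m by omega]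
    unfold broomQuad
    push_cast
    ring
end

section
/- For every tree G of order n ≥ 2, T_bestmeet(G) ≥ 1/2, with equality if and only if G is isomorphic to the star S_n; in particular min over all trees of order n of T_bestmeet equals T_bestmeet(S_n) = 1/2. -/
open Finset
open scoped Classical

section

variable {V : Type*} {G : SimpleGraph V}

theorem ell_nonneg (hG : G.Connected) (u v w : V) : 0 ≤ ell G u v w := by
  have h := hG.dist_triangle (u := u) (v := w) (w := v)
  rw [G.dist_comm (u := w)] at h
  have h' : (G.dist u v : ℚ) ≤ G.dist u w + G.dist v w := mod_cast h
  unfold ell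
  linarith

theorem ell_self (G : SimpleGraph V) (u w : V) : ell G u u w = G.dist u w := by
  simp [ell]

theorem ell_starGraph (u v w : V) :
    ell (SimpleGraph.starGraph w) u v w = if u = v ∧ u ≠ w then 1 else 0 := by
  have hG := SimpleGraph.connected_starGraph w
  rcases eq_or_ne u w with rfl | hu
  · simp [ell, SimpleGraph.dist_comm]
  have dist_center {x : V} (hx : x ≠ w) : (SimpleGraph.starGraph w).dist x w = 1 :=
    SimpleGraph.dist_eq_one_iff_adj.mpr (SimpleGraph.starGraph_center_adj' hx.symm)
  rcases eq_or_ne u v with rfl | huv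
  · simp [ell_self, hu, dist_center hu]
  rcases eq_or_ne v w with rfl | hv
  · simp [ell, huv]
  rw [if_neg (by simp [huv])]
  refine le_antisymm ?_ (ell_nonneg hG u v w)
  have h0 := (hG.dist_eq_zero_iff (u := u) (v := v)).not.mpr huv
  have h1 : (SimpleGraph.starGraph w).dist u v ≠ 1 := by
    rw [Ne, SimpleGraph.dist_eq_one_iff_adj, SimpleGraph.starGraph_adj]
    tauto
  have h2 : (2 : ℚ) ≤ (SimpleGraph.starGraph w).dist u v := mod_cast (by omega)
  rw [ell, dist_center hu, dist_center hv]
  push_cast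
  linarith

variable [Fintype V]

theorem one_le_gdeg [Nontrivial V] (hG : G.Connected) (v : V) : 1 ≤ gdeg G v := by
  obtain ⟨u, hu⟩ := hG.preconnected.exists_adj_of_nontrivial v
  exact Finset.card_pos.mpr ⟨u, by simpa using hu⟩

theorem gdeg_starGraph_of_ne_center {v w : V} (h : v ≠ w) :
    gdeg (SimpleGraph.starGraph w) v = 1 := by
  rw [gdeg, Finset.card_eq_one]
  exact ⟨w, by ext u; simp only [mem_filter, mem_univ, SimpleGraph.starGraph_adj]; grind⟩

theorem sum_sq_gdeg_mul_dist_le_joinTime (hG : G.Connected) (w : V) :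
    ∑ u, (gdeg G u : ℚ) ^ 2 * G.dist u w ≤ joinTime G w := by
  refine Finset.sum_le_sum fun u _ => ?_
  have h : ell G u u w * (gdeg G u : ℚ) ≤ hitTime G u w :=
    Finset.single_le_sum (f := fun v => ell G u v w * (gdeg G v : ℚ))
      (fun v _ => mul_nonneg (ell_nonneg hG u v w) (Nat.cast_nonneg _)) (mem_univ u)
  calc (gdeg G u : ℚ) ^ 2 * G.dist u w = gdeg G u * (ell G u u w * gdeg G u) := by
        rw [ell_self]; ring
    _ ≤ gdeg G u * hitTime G u w := by gcongr

theorem sum_ite_ne_eq_card_sub_one (w : V) :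
    ∑ u, (if u ≠ w then (1 : ℚ) else 0) = Fintype.card V - 1 := by
  simp [Finset.sum_ite, Finset.filter_ne', Finset.card_erase_of_mem,
    Nat.cast_sub (Fintype.card_pos_iff.mpr ⟨w⟩)]

theorem ite_ne_le_sq_gdeg_mul_dist [Nontrivial V] (hG : G.Connected) (u w : V) :
    (if u ≠ w then (1 : ℚ) else 0) ≤ (gdeg G u : ℚ) ^ 2 * G.dist u w := by
  split_ifs with h
  · have hdist := hG.pos_dist_of_ne h
    have hdeg := one_le_gdeg hG u
    exact_mod_cast Nat.mul_pos (pow_pos hdeg 2) hdist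
  · positivity

theorem card_sub_one_le_joinTime [Nontrivial V] (hG : G.Connected) (w : V) :
    (Fintype.card V : ℚ) - 1 ≤ joinTime G w := by
  rw [← sum_ite_ne_eq_card_sub_one w]
  exact (Finset.sum_le_sum fun u _ => ite_ne_le_sq_gdeg_mul_dist hG u w).trans
    (sum_sq_gdeg_mul_dist_le_joinTime hG w)

theorem joinTime_starGraph_center (w : V) :
    joinTime (SimpleGraph.starGraph w) w = Fintype.card V - 1 := by
  rw [← sum_ite_ne_eq_card_sub_one w]
  refine Finset.sum_congr rfl fun u _ => ?_
  rcases eq_or_ne u w with rfl | hu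
  · simp [hitTime, ell_starGraph]
  · simp [hitTime, ell_starGraph, hu, gdeg_starGraph_of_ne_center]

theorem eq_starGraph_of_joinTime_eq [Nontrivial V] (hG : G.Connected) {w : V}
    (h : joinTime G w = Fintype.card V - 1) : G = SimpleGraph.starGraph w := by
  have hle := fun u (_ : u ∈ Finset.univ) => ite_ne_le_sq_gdeg_mul_dist hG u w
  have hsum : ∑ u, (if u ≠ w then (1 : ℚ) else 0) = ∑ u, (gdeg G u : ℚ) ^ 2 * G.dist u w :=
    le_antisymm (Finset.sum_le_sum hle)
      ((sum_sq_gdeg_mul_dist_le_joinTime hG w).trans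
        (h.trans (sum_ite_ne_eq_card_sub_one w).symm).le)
  have hterm {u : V} (hu : u ≠ w) : gdeg G u = 1 ∧ G.Adj u w := by
    have hu' := (Finset.sum_eq_sum_iff_of_le hle).mp hsum u (mem_univ u)
    rw [if_pos hu] at hu'
    have hmul : gdeg G u ^ 2 * G.dist u w = 1 := mod_cast hu'.symm
    rw [mul_eq_one, SimpleGraph.dist_eq_one_iff_adj] at hmul
    exact ⟨by simpa using hmul.1, hmul.2⟩
  have hunique {u x : V} (hu : u ≠ w) (hx : G.Adj u x) : x = w :=
    Finset.card_le_one.mp (hterm hu).1.le x (by simpa using hx) w (by simpa using (hterm hu).2)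
  ext x y
  rw [SimpleGraph.starGraph_adj]
  refine ⟨fun hxy => ⟨hxy.ne, or_iff_not_imp_left.mpr fun hx => hunique hx hxy⟩, ?_⟩
  rintro ⟨hxy, rfl | rfl⟩
  · exact (hterm hxy.symm).2.symm
  · exact (hterm hxy).2

theorem Jmin_eq_inf' [Nonempty V] (G : SimpleGraph V) :
    Jmin G = Finset.univ.inf' Finset.univ_nonempty (joinTime G) :=
  dif_pos ‹_›

theorem card_sub_one_le_Jmin [Nontrivial V] (hG : G.Connected) :
    (Fintype.card V : ℚ) - 1 ≤ Jmin G := by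
  rw [Jmin_eq_inf']
  exact Finset.le_inf' _ _ fun w _ => card_sub_one_le_joinTime hG w

theorem Jmin_eq_card_sub_one_iff [Nontrivial V] (hG : G.Connected) :
    Jmin G = Fintype.card V - 1 ↔ ∃ w, G = SimpleGraph.starGraph w := by
  constructor
  · intro h
    obtain ⟨w, -, hw⟩ := Finset.exists_mem_eq_inf' Finset.univ_nonempty (joinTime G)
    exact ⟨w, eq_starGraph_of_joinTime_eq hG (by rw [← hw, ← Jmin_eq_inf', h])⟩
  · rintro ⟨w, rfl⟩
    refine le_antisymm ?_ (card_sub_one_le_Jmin hG)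
    rw [Jmin_eq_inf', ← joinTime_starGraph_center w]
    exact Finset.inf'_le _ (mem_univ w)

theorem card_sub_one_pos [Nontrivial V] : (0 : ℚ) < Fintype.card V - 1 :=
  sub_pos.mpr (mod_cast Fintype.one_lt_card)

theorem half_le_bestMeet [Nontrivial V] (hG : G.Connected) : (1 / 2 : ℚ) ≤ bestMeet G := by
  have hpos := card_sub_one_pos (V := V)
  rw [bestMeet, le_div_iff₀ (by positivity)]
  linarith [card_sub_one_le_Jmin hG]

theorem bestMeet_eq_half_iff [Nontrivial V] (hG : G.Connected) :
    bestMeet G = 1 / 2 ↔ ∃ w, G = SimpleGraph.starGraph w := by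
  have hpos := card_sub_one_pos (V := V)
  rw [← Jmin_eq_card_sub_one_iff hG, bestMeet, div_eq_iff (by positivity)]
  constructor <;> intro h <;> linarith

theorem starGraph_eq_simpleGraph_starGraph (n : ℕ) [NeZero n] :
    starGraph n = SimpleGraph.starGraph 0 := by
  ext i j
  rw [starGraph, SimpleGraph.fromRel_adj, SimpleGraph.starGraph_adj]
  simp

theorem nonempty_iso_starGraph_iff {n : ℕ} [NeZero n] (hcard : Fintype.card V = n) :
    Nonempty (G ≃g starGraph n) ↔ ∃ w, G = SimpleGraph.starGraph w := by
  rw [starGraph_eq_simpleGraph_starGraph]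
  constructor
  · rintro ⟨f⟩
    refine ⟨f.symm 0, ?_⟩
    ext x y
    rw [← f.map_adj_iff]
    simp [SimpleGraph.starGraph_adj, RelIso.eq_symm_apply]
  · rintro ⟨w, rfl⟩
    let e := Fintype.equivFinOfCardEq hcard
    let f := e.trans (Equiv.swap (e w) 0)
    have hf : f w = 0 := by simp [f]
    refine ⟨f, fun {x y} => ?_⟩
    simp only [SimpleGraph.starGraph_adj, ← hf, f.injective.eq_iff, Ne]

end

/-- every tree of order `n ≥ 2` has best meeting time at least `1/2`, with
equality exactly for the star `S_n`. -/
theorem bestMeet_ge_half (n : ℕ) (hn : 2 ≤ n)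
    {V : Type*} [Fintype V] (G : SimpleGraph V)
    (hT : G.IsTree) (hcard : Fintype.card V = n) :
    (1/2 : ℚ) ≤ bestMeet G ∧
    (bestMeet G = 1/2 ↔ Nonempty (G ≃g starGraph n)) ∧
    bestMeet (starGraph n) = 1/2 := by
  have : Nontrivial V := Fintype.one_lt_card_iff_nontrivial.mp (by omega)
  have : NeZero n := ⟨by omega⟩
  have : Nontrivial (Fin n) := Fin.nontrivial_iff_two_le.mpr hn
  refine ⟨half_le_bestMeet hT.connected, ?_, ?_⟩
  · rw [bestMeet_eq_half_iff hT.connected, nonempty_iso_starGraph_iff hcard]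
  · rw [starGraph_eq_simpleGraph_starGraph]
    exact (bestMeet_eq_half_iff (SimpleGraph.connected_starGraph _)).mpr ⟨0, rfl⟩
end

section
/- Let n ≥ 2 be even. For every tree G of order n, T_bestmeet(G) ≤ (n² − 2n + 3)/6, and this bound is attained by the path P_n, i.e., max over trees of order n of T_bestmeet equals T_bestmeet(P_n) = (n² − 2n + 3)/6. -/
open Finset
open scoped Classical

/-- `par` sends each vertex other than `r` to its neighbour closer to the root `r`, and
these are the only edges of the connected graph `G`. -/
structure IsRooting {V : Type*} (G : SimpleGraph V) (r : V) (par : V → V) : Prop where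
  connected : G.Connected
  adj_iff : ∀ u v, G.Adj u v ↔ (u ≠ r ∧ par u = v) ∨ (v ≠ r ∧ par v = u)
  dist_par : ∀ u, u ≠ r → G.dist (par u) r + 1 = G.dist u r

theorem IsRooting.adj_par {V : Type*} {G : SimpleGraph V} {r : V} {par : V → V}
    (h : IsRooting G r par) {u : V} (hu : u ≠ r) : G.Adj u (par u) :=
  (h.adj_iff _ _).2 (Or.inl ⟨hu, rfl⟩)

theorem SimpleGraph.IsTree.exists_isRooting {V : Type*} {G : SimpleGraph V} (hG : G.IsTree)
    (r : V) : ∃ par, IsRooting G r par := by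
  have lower : ∀ u, u ≠ r → ∃ v, G.Adj u v ∧ G.dist v r + 1 = G.dist u r := by
    intro u hu
    obtain ⟨p, hp⟩ := hG.connected.exists_walk_length_eq_dist u r
    cases p with
    | nil => exact absurd rfl hu
    | @cons _ v _ h q =>
      refine ⟨v, h, ?_⟩
      have h1 := SimpleGraph.dist_le q
      have h2 := hG.connected.dist_triangle (u := u) (v := v) (w := r)
      have h3 := SimpleGraph.dist_eq_one_iff_adj.2 h
      simp only [SimpleGraph.Walk.length_cons] at hp
      omega
  have lower_unique : ∀ u a b, G.Adj u a → G.Adj u b → G.dist a r + 1 = G.dist u r →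
      G.dist b r + 1 = G.dist u r → a = b := by
    intro u a b ha hb hda hdb
    obtain ⟨p, hp⟩ := hG.connected.exists_walk_length_eq_dist a r
    obtain ⟨q, hq⟩ := hG.connected.exists_walk_length_eq_dist b r
    have hp' := (SimpleGraph.Walk.cons ha p).isPath_of_length_eq_dist (by simp [hp, hda])
    have hq' := (SimpleGraph.Walk.cons hb q).isPath_of_length_eq_dist (by simp [hq, hdb])
    have h := (hG.existsUnique_path u r).unique hp' hq'
    injection h
  choose f hf using lower
  refine ⟨fun u => if hu : u = r then r else f u hu, hG.connected, ?_, ?_⟩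
  · have key : ∀ u v, G.Adj u v → G.dist v r + 1 = G.dist u r →
        u ≠ r ∧ (if hu : u = r then r else f u hu) = v := by
      intro u v huv hd
      have hu : u ≠ r := by
        rintro rfl
        simp at hd
      refine ⟨hu, ?_⟩
      rw [dif_neg hu]
      exact lower_unique u _ _ (hf u hu).1 huv (hf u hu).2 hd
    intro u v
    constructor
    · intro h
      rcases hG.dist_eq_dist_add_one_of_adj r h with hd | hd
      · left
        refine key u v h ?_
        rw [SimpleGraph.dist_comm, ← hd, SimpleGraph.dist_comm]
      · right
        refine key v u h.symm ?_
        rw [SimpleGraph.dist_comm, ← hd, SimpleGraph.dist_comm]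
    · rintro (⟨hu, rfl⟩ | ⟨hv, rfl⟩)
      · rw [dif_neg hu]
        exact (hf u hu).1
      · rw [dif_neg hv]
        exact (hf v hv).1.symm
  · intro u hu
    rw [dif_neg hu]
    exact (hf u hu).2

/-- The descendants of `x` (itself included) when the tree is rooted at `r`. -/
noncomputable def desc {V : Type*} [Fintype V] (G : SimpleGraph V) (r x : V) : Finset V :=
  univ.filter fun u => G.dist u r = G.dist u x + G.dist x r

/-- The ancestors of `u` (itself included) other than the root `r`. -/
noncomputable def anc {V : Type*} [Fintype V] (G : SimpleGraph V) (r u : V) : Finset V :=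
  univ.filter fun x => x ≠ r ∧ u ∈ desc G r x

section Rooting

variable {V : Type*} [Fintype V] {G : SimpleGraph V} {r : V} {par : V → V}

theorem mem_desc {x u : V} : u ∈ desc G r x ↔ G.dist u r = G.dist u x + G.dist x r := by
  simp [desc]

theorem mem_anc {x u : V} : x ∈ anc G r u ↔ x ≠ r ∧ u ∈ desc G r x := by
  simp [anc]

theorem self_mem_desc (x : V) : x ∈ desc G r x := by
  simp [mem_desc]

theorem dist_le_of_mem_desc {x u : V} (h : u ∈ desc G r x) : G.dist x r ≤ G.dist u r := by
  rw [mem_desc] at h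
  omega

namespace IsRooting

theorem mem_desc_trans (h : IsRooting G r par) {x y z : V} (hy : y ∈ desc G r x)
    (hz : z ∈ desc G r y) : z ∈ desc G r x := by
  rw [mem_desc] at *
  have h1 := h.connected.dist_triangle (u := z) (v := y) (w := x)
  have h2 := h.connected.dist_triangle (u := z) (v := x) (w := r)
  omega

theorem dist_lt_of_mem_desc (h : IsRooting G r par) {x u : V} (hu : u ∈ desc G r x)
    (hne : u ≠ x) : G.dist x r < G.dist u r := by
  rw [mem_desc] at hu
  have := h.connected.pos_dist_of_ne hne
  omega

theorem root_notMem_desc (h : IsRooting G r par) {x : V} (hx : x ≠ r) : r ∉ desc G r x := by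
  intro hr
  have := h.dist_lt_of_mem_desc hr hx.symm
  simp at this

theorem mem_desc_iff_par_mem (h : IsRooting G r par) {u x : V} (hu : u ≠ r) (hux : u ≠ x) :
    u ∈ desc G r x ↔ par u ∈ desc G r x := by
  rw [mem_desc, mem_desc]
  have hd := h.dist_par u hu
  have h1 := SimpleGraph.dist_eq_one_iff_adj.2 (h.adj_par hu)
  constructor
  · intro hm
    obtain ⟨p, hp⟩ := h.connected.exists_walk_length_eq_dist u x
    cases p with
    | nil => exact absurd rfl hux
    | @cons _ v _ hv q =>
      have h2 := SimpleGraph.dist_le q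
      have h3 := h.connected.dist_triangle (u := v) (v := x) (w := r)
      simp only [SimpleGraph.Walk.length_cons] at hp
      rcases (h.adj_iff _ _).1 hv with ⟨_, rfl⟩ | ⟨hvr, rfl⟩
      · have h4 := h.connected.dist_triangle (u := u) (v := par u) (w := x)
        omega
      · have := h.dist_par v hvr
        omega
  · intro hm
    have h3 := h.connected.dist_triangle (u := u) (v := x) (w := r)
    have h4 := h.connected.dist_triangle (u := u) (v := par u) (w := x)
    omega

theorem par_notMem_desc (h : IsRooting G r par) {x : V} (hx : x ≠ r) : par x ∉ desc G r x := by
  intro hm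
  have h1 := dist_le_of_mem_desc hm
  have h2 := h.dist_par x hx
  omega

theorem mem_desc_of_common (h : IsRooting G r par) {x y z : V} (hx : z ∈ desc G r x)
    (hy : z ∈ desc G r y) (hd : G.dist y r ≤ G.dist x r) : x ∈ desc G r y := by
  induction hk : G.dist z r generalizing z with
  | zero =>
    have h1 := dist_le_of_mem_desc hx
    have hz : z = x := by
      by_contra hne
      have := h.dist_lt_of_mem_desc hx hne
      omega
    exact hz ▸ hy
  | succ k ih =>
    by_cases hzx : z = x
    · exact hzx ▸ hy
    have h1 := h.dist_lt_of_mem_desc hx hzx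
    have hzy : z ≠ y := by
      rintro rfl
      omega
    have hzr : z ≠ r := by
      rintro rfl
      simp at hk
    have h2 := h.dist_par z hzr
    exact ih ((h.mem_desc_iff_par_mem hzr hzx).1 hx) ((h.mem_desc_iff_par_mem hzr hzy).1 hy)
      (by omega)

theorem anc_root (h : IsRooting G r par) : anc G r r = ∅ := by
  ext x
  simp only [mem_anc, notMem_empty, iff_false, not_and]
  exact fun hx => h.root_notMem_desc hx

theorem notMem_anc_par (h : IsRooting G r par) {u : V} (hu : u ≠ r) : u ∉ anc G r (par u) :=
  fun hm => h.par_notMem_desc hu (mem_anc.1 hm).2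

theorem anc_eq_insert (h : IsRooting G r par) {u : V} (hu : u ≠ r) :
    anc G r u = insert u (anc G r (par u)) := by
  ext x
  rw [mem_insert, mem_anc, mem_anc]
  by_cases hx : x = u
  · subst hx
    simp [hu, self_mem_desc]
  · rw [h.mem_desc_iff_par_mem hu (Ne.symm hx)]
    simp [hx]

theorem card_anc (h : IsRooting G r par) (u : V) : #(anc G r u) = G.dist u r := by
  induction hk : G.dist u r generalizing u with
  | zero =>
    have : u = r := h.connected.dist_eq_zero_iff.1 hk
    rw [this, h.anc_root, card_empty]
  | succ k ih =>
    have hur : u ≠ r := by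
      rintro rfl
      simp at hk
    rw [h.anc_eq_insert hur, card_insert_of_notMem (h.notMem_anc_par hur),
      ih _ (by have := h.dist_par u hur; omega)]

theorem dist_add_card_le (h : IsRooting G r par) (u v : V) :
    G.dist u v + 2 * #(anc G r u ∩ anc G r v) ≤ G.dist u r + G.dist v r := by
  induction hk : G.dist u r + G.dist v r using Nat.strong_induction_on generalizing u v with
  | _ k ih =>
    subst hk
    wlog hd : G.dist v r ≤ G.dist u r generalizing u v
    · have := this v u (fun m hm a b hab => ih m (by omega) a b hab) (by omega)
      rw [SimpleGraph.dist_comm, inter_comm]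
      omega
    by_cases huv : u = v
    · subst huv
      rw [inter_self, h.card_anc, SimpleGraph.dist_self]
      omega
    have hur : u ≠ r := by
      rintro rfl
      rw [SimpleGraph.dist_self, Nat.le_zero] at hd
      exact huv (h.connected.dist_eq_zero_iff.1 hd).symm
    have hnot : u ∉ anc G r v := by
      intro hm
      have := h.dist_lt_of_mem_desc (mem_anc.1 hm).2 (Ne.symm huv)
      omega
    have h1 := h.dist_par u hur
    have h2 := ih _ (by omega) (par u) v rfl
    have h3 := h.connected.dist_triangle (u := u) (v := par u) (w := v)
    have h4 := SimpleGraph.dist_eq_one_iff_adj.2 (h.adj_par hur)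
    rw [h.anc_eq_insert hur, insert_inter_of_notMem hnot]
    omega

theorem card_anc_add_le_length (h : IsRooting G r par) {u v : V} (p : G.Walk u v) :
    #(anc G r u) + #(anc G r v) ≤ p.length + 2 * #(anc G r u ∩ anc G r v) := by
  induction p with
  | nil =>
    rw [inter_self]
    omega
  | @cons u w v hadj q ih =>
    rw [SimpleGraph.Walk.length_cons]
    rcases (h.adj_iff _ _).1 hadj with ⟨hu, rfl⟩ | ⟨hw, rfl⟩
    · have h1 := card_le_card (inter_subset_inter_right (u := anc G r v)
        (subset_insert u (anc G r (par u))))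
      rw [h.anc_eq_insert hu, card_insert_of_notMem (h.notMem_anc_par hu)]
      omega
    · rw [h.anc_eq_insert hw, card_insert_of_notMem (h.notMem_anc_par hw)] at ih
      have h1 : #(insert w (anc G r (par w)) ∩ anc G r v) ≤
          #(anc G r (par w) ∩ anc G r v) + 1 := by
        refine (card_le_card ?_).trans (card_insert_le w _)
        intro x
        simp only [mem_inter, mem_insert]
        tauto
      omega

theorem ell_eq (h : IsRooting G r par) (u v : V) :
    ell G u v r = (#(anc G r u ∩ anc G r v) : ℚ) := by
  obtain ⟨p, hp⟩ := h.connected.exists_walk_length_eq_dist u v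
  have h1 := h.card_anc_add_le_length p
  have h2 := h.dist_add_card_le u v
  rw [h.card_anc, h.card_anc, hp] at h1
  have h3 : (G.dist u r : ℚ) + G.dist v r = G.dist u v + 2 * #(anc G r u ∩ anc G r v) := by
    exact_mod_cast le_antisymm h1 h2
  rw [ell, h3]
  ring

theorem gdeg_eq (h : IsRooting G r par) (u : V) :
    gdeg G u = (if u ≠ r then 1 else 0) + #{y | y ≠ r ∧ par y = u} := by
  have hsplit : (univ.filter fun y => G.Adj u y) =
      (if u ≠ r then {par u} else ∅) ∪ univ.filter fun y => y ≠ r ∧ par y = u := by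
    ext y
    by_cases hu : u = r
    · simp [h.adj_iff, hu]
    · simp [h.adj_iff, hu, eq_comm]
  rw [gdeg, hsplit, card_union_of_disjoint]
  · split_ifs <;> simp
  · split_ifs with hu
    · simp only [disjoint_singleton_left, mem_filter, mem_univ, true_and, not_and]
      intro h1 h2
      have h3 := h.dist_par _ h1
      have h4 := h.dist_par _ hu
      rw [h2] at h3
      omega
    · simp

theorem sum_gdeg_desc (h : IsRooting G r par) {x : V} (hx : x ≠ r) :
    ∑ u ∈ desc G r x, gdeg G u + 1 = 2 * #(desc G r x) := by
  have h1 : ∑ u ∈ desc G r x, (if u ≠ r then 1 else 0) = #(desc G r x) := by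
    rw [card_eq_sum_ones]
    refine sum_congr rfl fun u hu => if_pos ?_
    rintro rfl
    exact h.root_notMem_desc hx hu
  have h2 : ∑ u ∈ desc G r x, #{y | y ≠ r ∧ par y = u} = #((desc G r x).erase x) := by
    rw [← card_biUnion]
    · congr 1
      ext y
      simp only [mem_biUnion, mem_filter, mem_univ, true_and, mem_erase]
      constructor
      · rintro ⟨u, hu, hy, rfl⟩
        have hyx : y ≠ x := by
          rintro rfl
          exact h.par_notMem_desc hy hu
        exact ⟨hyx, (h.mem_desc_iff_par_mem hy hyx).2 hu⟩
      · rintro ⟨hyx, hy⟩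
        have hyr : y ≠ r := by
          rintro rfl
          exact h.root_notMem_desc hx hy
        exact ⟨par y, (h.mem_desc_iff_par_mem hyr hyx).1 hy, hyr, rfl⟩
    · intro a _ b _ hab
      rw [Function.onFun, disjoint_left]
      simp only [mem_filter, mem_univ, true_and, not_and]
      rintro y ⟨_, rfl⟩ _
      exact hab
  rw [sum_congr rfl fun u _ => h.gdeg_eq u, sum_add_distrib, h1, h2,
    card_erase_of_mem (self_mem_desc x)]
  have := card_pos.2 ⟨x, self_mem_desc (G := G) (r := r) x⟩
  omega

theorem joinTime_eq (h : IsRooting G r par) :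
    joinTime G r = ∑ x ∈ univ.erase r, (2 * (#(desc G r x) : ℚ) - 1) ^ 2 := by
  have hell : ∀ u v, ell G u v r = ∑ x ∈ univ.erase r,
      (if u ∈ desc G r x then (1 : ℚ) else 0) * (if v ∈ desc G r x then (1 : ℚ) else 0) := by
    intro u v
    rw [h.ell_eq, card_eq_sum_ones, Nat.cast_sum]
    simp_rw [ite_zero_mul_ite_zero, mul_one]
    rw [← sum_filter]
    refine sum_congr ?_ fun _ _ => by simp
    ext x
    simp only [mem_inter, mem_anc, mem_filter, mem_erase, mem_univ, and_true]
    tauto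
  have hvol : ∀ x ∈ univ.erase r, 2 * (#(desc G r x) : ℚ) - 1 =
      ∑ u, (gdeg G u : ℚ) * (if u ∈ desc G r x then (1 : ℚ) else 0) := by
    intro x hx
    have h1 : (∑ u ∈ desc G r x, (gdeg G u : ℚ)) + 1 = 2 * (#(desc G r x) : ℚ) := by
      exact_mod_cast h.sum_gdeg_desc (ne_of_mem_erase hx)
    simp only [mul_ite, mul_one, mul_zero, sum_ite_mem, univ_inter]
    linarith
  rw [sum_congr rfl fun x hx => by rw [hvol x hx, sq, sum_mul_sum]]
  rw [joinTime, sum_comm]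
  refine sum_congr rfl fun u _ => ?_
  rw [sum_comm, hitTime, mul_sum]
  refine sum_congr rfl fun v _ => ?_
  rw [hell, sum_mul, mul_sum]
  exact sum_congr rfl fun x _ => by ring

theorem card_le_of_two_mul_card_desc_le (h : IsRooting G r par)
    (hhalf : ∀ x, x ≠ r → 2 * #(desc G r x) ≤ Fintype.card V) {k : ℕ}
    (hne : ∃ x, x ≠ r ∧ k ≤ #(desc G r x)) :
    #{x | x ≠ r ∧ k ≤ #(desc G r x)} + 2 * k ≤ Fintype.card V + 1 := by
  set A : Finset V := univ.filter fun x => x ≠ r ∧ k ≤ #(desc G r x) with hA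
  have mem_A : ∀ {x}, x ∈ A ↔ x ≠ r ∧ k ≤ #(desc G r x) := by simp [hA]
  have hrA : r ∉ A := fun hr => (mem_A.1 hr).1 rfl
  obtain ⟨x, hxA, hxmax⟩ := A.exists_max_image (fun x => G.dist x r)
    (hne.imp fun x hx => mem_A.2 hx)
  have hxr := (mem_A.1 hxA).1
  have hxk := (mem_A.1 hxA).2
  have hxdisj : Disjoint A ((desc G r x).erase x) := by
    rw [disjoint_left]
    intro z hz hzx
    rw [mem_erase] at hzx
    have h1 := h.dist_lt_of_mem_desc hzx.2 hzx.1
    have h2 := hxmax z hz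
    omega
  have hxcard := card_erase_add_one (self_mem_desc (G := G) (r := r) x)
  by_cases hchain : ∃ y ∈ A, x ∉ desc G r y
  · obtain ⟨y, hyB, hymax⟩ := (A.filter fun y => x ∉ desc G r y).exists_max_image
      (fun y => G.dist y r) (hchain.imp fun y hy => mem_filter.2 hy)
    rw [mem_filter] at hyB
    have hyr := (mem_A.1 hyB.1).1
    have hyk := (mem_A.1 hyB.1).2
    have hycard := card_erase_add_one (self_mem_desc (G := G) (r := r) y)
    have hydisj : Disjoint A ((desc G r y).erase y) := by
      rw [disjoint_left]
      intro z hz hzy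
      rw [mem_erase] at hzy
      have h1 := h.dist_lt_of_mem_desc hzy.2 hzy.1
      have h2 := hymax z
      rw [mem_filter] at h2
      by_cases hxz : x ∈ desc G r z
      · exact hyB.2 (h.mem_desc_trans hzy.2 hxz)
      · have := h2 ⟨hz, hxz⟩
        omega
    have hxy : Disjoint ((desc G r x).erase x) ((desc G r y).erase y) := by
      rw [disjoint_left]
      intro z hzx hzy
      exact hyB.2 (h.mem_desc_of_common (mem_of_mem_erase hzx) (mem_of_mem_erase hzy)
        (hxmax y hyB.1))
    have hr : r ∉ A ∪ ((desc G r x).erase x ∪ (desc G r y).erase y) := by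
      simp only [mem_union, mem_erase, not_or, not_and]
      exact ⟨hrA, fun _ => h.root_notMem_desc hxr, fun _ => h.root_notMem_desc hyr⟩
    have hle := card_le_univ (insert r (A ∪ ((desc G r x).erase x ∪ (desc G r y).erase y)))
    rw [card_insert_of_notMem hr, card_union_of_disjoint
      (disjoint_union_right.2 ⟨hxdisj, hydisj⟩), card_union_of_disjoint hxy] at hle
    omega
  · push Not at hchain
    obtain ⟨t, htA, htmin⟩ := A.exists_min_image (fun x => G.dist x r) ⟨x, hxA⟩
    have htr := (mem_A.1 htA).1
    have hsub : A ∪ (desc G r x).erase x ⊆ desc G r t := by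
      refine union_subset (fun y hy => ?_) fun z hz => ?_
      · exact h.mem_desc_of_common (hchain y hy) (hchain t htA) (htmin y hy)
      · exact h.mem_desc_trans (hchain t htA) (mem_of_mem_erase hz)
    have hle := card_le_card hsub
    rw [card_union_of_disjoint hxdisj] at hle
    have h1 := hhalf t htr
    have h2 := hhalf x hxr
    omega

theorem two_mul_card_desc_le (h : IsRooting G r par)
    (hmin : ∀ x, ∑ u, G.dist u r ≤ ∑ u, G.dist u x) (x : V) (hx : x ≠ r) :
    2 * #(desc G r x) ≤ Fintype.card V := by
  induction hk : G.dist x r generalizing x with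
  | zero => exact absurd (h.connected.dist_eq_zero_iff.1 hk) hx
  | succ k ih =>
    by_cases hpx : par x = r
    · have hd := h.dist_par x hx
      rw [hpx, SimpleGraph.dist_self] at hd
      have hpt : ∀ u ∈ univ, G.dist u x + 2 * (if u ∈ desc G r x then 1 else 0) ≤
          G.dist u r + 1 := by
        intro u _
        split_ifs with hu
        · rw [mem_desc] at hu
          omega
        · have h1 := h.connected.dist_triangle (u := u) (v := r) (w := x)
          rw [SimpleGraph.dist_comm (u := r)] at h1
          omega
      have hs := sum_le_sum hpt
      rw [sum_add_distrib, sum_add_distrib, ← mul_sum, sum_ite_mem, univ_inter,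
        ← card_eq_sum_ones, ← card_eq_sum_ones, card_univ] at hs
      have := hmin x
      omega
    · have hd := h.dist_par x hx
      refine le_trans ?_ (ih (par x) hpx (by omega))
      refine Nat.mul_le_mul_left 2 (card_le_card fun z hz => ?_)
      refine h.mem_desc_trans ?_ hz
      have hne : x ≠ par x := (h.adj_par hx).ne
      exact (h.mem_desc_iff_par_mem hx hne).2 (self_mem_desc _)

end IsRooting

end Rooting

theorem sum_range_eight_mul (s : ℕ) (c : ℚ) :
    ∑ j ∈ range s, 8 * (j : ℚ) * (c - 2 * j) =
      4 * c * s * (s - 1) - 8 * (s * (s - 1) * (2 * s - 1)) / 3 := by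
  induction s with
  | zero => simp
  | succ s ih =>
    rw [sum_range_succ, ih]
    push_cast
    ring

theorem two_mul_sub_one_sq_eq_sum {s m : ℕ} (hsm : s ≤ m) :
    (2 * (s : ℚ) - 1) ^ 2 = 1 + ∑ j ∈ range m, if j + 1 ≤ s then 8 * (j : ℚ) else 0 := by
  have h1 : (range m).filter (fun j => j + 1 ≤ s) = range s := by
    ext j
    simp only [mem_filter, mem_range]
    omega
  have h2 : ∀ s : ℕ, ∑ j ∈ range s, 8 * (j : ℚ) = 4 * s * (s - 1) := by
    intro s
    induction s with
    | zero => simp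
    | succ s ih =>
      rw [sum_range_succ, ih]
      push_cast
      ring
  rw [← sum_filter, h1, h2]
  ring

theorem IsRooting.joinTime_le {V : Type*} [Fintype V] {G : SimpleGraph V} {r : V} {par : V → V}
    (h : IsRooting G r par) {m : ℕ} (hcard : Fintype.card V = 2 * m)
    (hhalf : ∀ x, x ≠ r → 2 * #(desc G r x) ≤ Fintype.card V) :
    joinTime G r ≤ (2 * (m : ℚ) - 1) * (4 * m ^ 2 - 4 * m + 3) / 3 := by
  have hlevel : ∀ j ∈ range m, (∑ x ∈ univ.erase r, if j + 1 ≤ #(desc G r x) then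
      8 * (j : ℚ) else 0) ≤ 8 * (j : ℚ) * ((2 * m - 1) - 2 * j) := by
    intro j hj
    rw [mem_range] at hj
    have hN : #{x | x ≠ r ∧ j + 1 ≤ #(desc G r x)} + 2 * j + 1 ≤ 2 * m := by
      by_cases hne : ∃ x, x ≠ r ∧ j + 1 ≤ #(desc G r x)
      · have := h.card_le_of_two_mul_card_desc_le hhalf hne
        omega
      · push Not at hne
        rw [filter_false_of_mem fun x _ hx => by have := hne x hx.1; omega, card_empty]
        omega
    have hfilter : (univ.erase r).filter (fun x => j + 1 ≤ #(desc G r x)) =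
        univ.filter fun x => x ≠ r ∧ j + 1 ≤ #(desc G r x) := by
      ext x
      simp
    rw [← sum_filter, hfilter, sum_const, nsmul_eq_mul, mul_comm]
    have hN' : (#{x | x ≠ r ∧ j + 1 ≤ #(desc G r x)} : ℚ) + 2 * j + 1 ≤ 2 * m := by
      exact_mod_cast hN
    refine mul_le_mul_of_nonneg_left ?_ (by positivity)
    linarith
  rw [h.joinTime_eq, sum_congr rfl fun x hx => two_mul_sub_one_sq_eq_sum (m := m) (by
    have := hhalf x (ne_of_mem_erase hx); omega), sum_add_distrib, sum_comm]
  have hm : 1 ≤ 2 * m := hcard ▸ Fintype.card_pos_iff.2 ⟨r⟩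
  have h1 : ∑ _x ∈ univ.erase r, (1 : ℚ) = 2 * m - 1 := by
    rw [sum_const, card_erase_of_mem (mem_univ r), card_univ, hcard, nsmul_eq_mul, mul_one,
      Nat.cast_sub hm]
    push_cast
    ring
  have h2 := sum_le_sum hlevel
  rw [sum_range_eight_mul] at h2
  rw [h1]
  refine (add_le_add_right h2 _).trans (le_of_eq ?_)
  ring

theorem Jmin_le {V : Type*} [Fintype V] (G : SimpleGraph V) (w : V) :
    Jmin G ≤ joinTime G w := by
  rw [Jmin, dif_pos ⟨w⟩]
  exact inf'_le _ (mem_univ w)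

theorem le_Jmin {V : Type*} [Fintype V] [Nonempty V] {G : SimpleGraph V} {a : ℚ}
    (h : ∀ w, a ≤ joinTime G w) : a ≤ Jmin G := by
  rw [Jmin, dif_pos ‹_›]
  exact le_inf' _ _ fun w _ => h w

theorem dist_pathGraph {n : ℕ} (u v : Fin n) :
    (SimpleGraph.pathGraph n).dist u v = (u : ℕ) - v + (v - u) := by
  have hconn : (SimpleGraph.pathGraph n).Connected :=
    have : Nonempty (Fin n) := ⟨u⟩
    ⟨SimpleGraph.pathGraph_preconnected n⟩
  refine le_antisymm ?_ ?_
  · wlog huv : u ≤ v generalizing u v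
    · rw [SimpleGraph.dist_comm, add_comm]
      exact this v u (le_of_not_ge huv)
    obtain ⟨k, hk⟩ := Nat.exists_eq_add_of_le (Fin.le_def.1 huv)
    induction k generalizing v with
    | zero =>
      have : u = v := Fin.ext (by omega)
      subst this
      simp
    | succ k ih =>
      have hlt : (u : ℕ) + k < n := by have := v.isLt; omega
      have h1 := ih ⟨u + k, hlt⟩ (Fin.le_def.2 (by simp)) (by simp)
      have h2 : (SimpleGraph.pathGraph n).Adj ⟨u + k, hlt⟩ v :=
        SimpleGraph.pathGraph_adj.2 (Or.inl (by simp; omega))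
      have h3 := hconn.dist_triangle (u := u) (v := ⟨u + k, hlt⟩) (w := v)
      rw [SimpleGraph.dist_eq_one_iff_adj.2 h2] at h3
      simp only at h1
      omega
  · obtain ⟨p, hp⟩ := hconn.exists_walk_length_eq_dist u v
    rw [← hp]
    clear hp
    induction p with
    | nil => simp
    | cons hadj q ih =>
      rw [SimpleGraph.pathGraph_adj] at hadj
      rw [SimpleGraph.Walk.length_cons]
      omega

theorem exists_isRooting_pathGraph {n : ℕ} (r : Fin n) :
    ∃ par, IsRooting (SimpleGraph.pathGraph n) r par := by
  refine ⟨fun u => if r < u then ⟨u - 1, by omega⟩ else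
    if hu : u < r then ⟨u + 1, by omega⟩ else u, ?_, ?_, ?_⟩
  · have : Nonempty (Fin n) := ⟨r⟩
    exact ⟨SimpleGraph.pathGraph_preconnected n⟩
  · intro u v
    rw [SimpleGraph.pathGraph_adj]
    split_ifs <;> simp only [Fin.ext_iff, Fin.lt_def, ne_eq] at * <;> omega
  · intro u hu
    rw [dist_pathGraph, dist_pathGraph]
    split_ifs <;> simp only [Fin.ext_iff, Fin.lt_def, ne_eq] at * <;> omega

theorem card_desc_pathGraph_of_lt {n : ℕ} {r x : Fin n} (h : r < x) :
    #(desc (SimpleGraph.pathGraph n) r x) = n - x := by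
  have : desc (SimpleGraph.pathGraph n) r x = Ici x := by
    ext u
    rw [mem_desc, dist_pathGraph, dist_pathGraph, dist_pathGraph, mem_Ici, Fin.le_def]
    rw [Fin.lt_def] at h
    omega
  rw [this, Fin.card_Ici]

theorem card_desc_pathGraph_of_gt {n : ℕ} {r x : Fin n} (h : x < r) :
    #(desc (SimpleGraph.pathGraph n) r x) = x + 1 := by
  have : desc (SimpleGraph.pathGraph n) r x = Iic x := by
    ext u
    rw [mem_desc, dist_pathGraph, dist_pathGraph, dist_pathGraph, mem_Iic, Fin.le_def]
    rw [Fin.lt_def] at h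
    omega
  rw [this, Fin.card_Iic]

theorem joinTime_pathGraph {n : ℕ} (r : Fin n) :
    joinTime (SimpleGraph.pathGraph n) r =
      (r * (4 * r ^ 2 - 1) + (n - 1 - r) * (4 * (n - 1 - r) ^ 2 - 1) : ℚ) / 3 := by
  obtain ⟨par, h⟩ := exists_isRooting_pathGraph r
  have hodd : ∀ b : ℕ, ∑ j ∈ range b, (2 * ((j : ℚ) + 1) - 1) ^ 2 =
      (b : ℚ) * (4 * (b : ℚ) ^ 2 - 1) / 3 := by
    intro b
    induction b with
    | zero => simp
    | succ b ih =>
      rw [sum_range_succ, ih]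
      push_cast
      ring
  have hval : ∀ x ∈ (univ : Finset (Fin n)).erase r,
      (2 * (#(desc (SimpleGraph.pathGraph n) r x) : ℚ) - 1) ^ 2 =
        if (x : ℕ) < r then (2 * ((x : ℚ) + 1) - 1) ^ 2 else (2 * ((n : ℚ) - x) - 1) ^ 2 := by
    intro x hx
    split_ifs with hlt
    · rw [card_desc_pathGraph_of_gt (Fin.lt_def.2 hlt)]
      push_cast
      rfl
    · have : r < x := lt_of_le_of_ne (Fin.le_def.2 (not_lt.1 hlt)) (ne_of_mem_erase hx).symm
      rw [card_desc_pathGraph_of_lt this, Nat.cast_sub x.isLt.le]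
  obtain ⟨b, hb⟩ := Nat.exists_eq_add_of_lt r.isLt
  have hsum := add_sum_erase (univ : Finset (Fin n)) (fun x : Fin n => if (x : ℕ) < r then
    (2 * ((x : ℚ) + 1) - 1) ^ 2 else (2 * ((n : ℚ) - x) - 1) ^ 2) (mem_univ r)
  have hJ : joinTime (SimpleGraph.pathGraph n) r =
      ∑ x ∈ univ.erase r, (2 * (#(desc (SimpleGraph.pathGraph n) r x) : ℚ) - 1) ^ 2 := by
    convert h.joinTime_eq
  rw [hJ, sum_congr rfl hval]
  have htotal : ∑ x : Fin n, (if (x : ℕ) < r then (2 * (((x : ℕ) : ℚ) + 1) - 1) ^ 2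
      else (2 * ((n : ℚ) - (x : ℕ)) - 1) ^ 2) =
      (r : ℚ) * (4 * (r : ℚ) ^ 2 - 1) / 3 +
        ((b : ℚ) + 1) * (4 * ((b : ℚ) + 1) ^ 2 - 1) / 3 := by
    rw [Fin.sum_univ_eq_sum_range (fun i : ℕ => if i < (r : ℕ) then (2 * ((i : ℚ) + 1) - 1) ^ 2
      else (2 * ((n : ℚ) - i) - 1) ^ 2) n]
    have hn : (n : ℚ) = r + b + 1 := by exact_mod_cast hb
    rw [congrArg range hb, add_assoc, sum_range_add, hn]
    congr 1
    · rw [← hodd]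
      exact sum_congr rfl fun j hj => if_pos (mem_range.1 hj)
    · have h1 := hodd (b + 1)
      push_cast at h1
      rw [← h1, ← sum_range_reflect]
      refine sum_congr rfl fun j hj => ?_
      rw [mem_range] at hj
      rw [if_neg (by omega), show b + 1 - 1 - j = b - j by omega]
      push_cast [Nat.cast_sub (show j ≤ b by omega)]
      ring
  have hn : (n : ℚ) = r + b + 1 := by exact_mod_cast hb
  rw [htotal] at hsum
  simp only [lt_irrefl, if_false] at hsum
  rw [hn] at hsum ⊢
  linear_combination hsum

/-- for even `n`, every tree of order `n` has best meeting time at most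
`(n² - 2n + 3)/6`, attained by the path `P_n`. -/
theorem bestMeet_le_path_even (n : ℕ) (hn : 2 ≤ n) (he : Even n)
    {V : Type*} [Fintype V] (G : SimpleGraph V)
    (hT : G.IsTree) (hcard : Fintype.card V = n) :
    bestMeet G ≤ ((n : ℚ)^2 - 2*(n : ℚ) + 3)/6 ∧
    bestMeet (SimpleGraph.pathGraph n) = ((n : ℚ)^2 - 2*(n : ℚ) + 3)/6 := by
  obtain ⟨m, rfl⟩ := he
  have hm : (1 : ℚ) ≤ m := by exact_mod_cast (show 1 ≤ m by omega)
  have hpos : (0 : ℚ) < 2 * (((m + m : ℕ) : ℚ) - 1) := by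
    push_cast
    linarith
  constructor
  · have := hT.connected.nonempty
    obtain ⟨r, -, hr⟩ := (univ : Finset V).exists_min_image (fun x => ∑ u, G.dist u x)
      univ_nonempty
    obtain ⟨par, h⟩ := hT.exists_isRooting r
    have hJ := h.joinTime_le (m := m) (by omega)
      (h.two_mul_card_desc_le fun x => hr x (mem_univ x))
    rw [bestMeet, hcard, div_le_iff₀ hpos]
    refine (Jmin_le G r).trans (hJ.trans (le_of_eq ?_))
    push_cast
    ring
  · have : Nonempty (Fin (m + m)) := ⟨⟨0, by omega⟩⟩
    rw [bestMeet, Fintype.card_fin, div_eq_iff hpos.ne']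
    refine le_antisymm ?_ (le_Jmin fun w => ?_)
    · refine (Jmin_le _ ⟨m, by omega⟩).trans (le_of_eq ?_)
      rw [joinTime_pathGraph]
      push_cast
      ring
    · rw [joinTime_pathGraph]
      have hint : ((w : ℕ) : ℤ) + 1 ≤ m ∨ (m : ℤ) ≤ (w : ℕ) := by omega
      have hsq : (0 : ℚ) ≤ ((w : ℕ) - m) * ((w : ℕ) + 1 - m) := by
        rcases hint with h | h
        · have h' : ((w : ℕ) : ℚ) + 1 ≤ m := by exact_mod_cast h
          nlinarith
        · have h' : (m : ℚ) ≤ (w : ℕ) := by exact_mod_cast h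
          nlinarith
      push_cast
      nlinarith [mul_nonneg hsq (show (0 : ℚ) ≤ 2 * m - 1 by linarith)]
end
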